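/- The number of permutations of size n (for n ≥ 3) having exactly one preimage under the PSB map equals the sum over k from 2 to ⌈n/2⌉ of (n-k)! · binomial(n-k-1, k-2). -/

import Mathlib

/-- `π` is a permutation of `{1,…,n}`, encoded as the list of its values. -/
def IsPermList (n : ℕ) (π : List ℕ) : Prop := π.Perm (List.range' 1 n)

/-- The pattern `σ` occurs in `π`: some subsequence of `π` is order-isomorphic to `σ`. -/
def Contains (π σ : List ℕ) : Prop :=
  ∃ τ : List ℕ, τ.Sublist π ∧ τ.length = σ.length ∧
    ∀ i j : ℕ, i < τ.length → j < τ.length → (τ[i]! < τ[j]! ↔ σ[i]! < σ[j]!)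

/-- `π` avoids the pattern `σ`. -/
def Avoids (π σ : List ℕ) : Prop := ¬ Contains π σ

/-- The pop stack with bypass sorting procedure (algorithm PSB); the second
argument is the pop stack, stored top-first.  Push if the stack is empty or the
current element is `TOP - 1`; bypass if it is `< TOP - 1`; otherwise pop the
whole stack and push.  At the end the stack is popped. -/
def psbAux : List ℕ → List ℕ → List ℕ
  | [], s => s
  | x :: xs, [] => psbAux xs [x]
  | x :: xs, t :: s =>
      if x + 1 = t then psbAux xs (x :: t :: s)
      else if x + 1 < t then x :: psbAux xs (t :: s)
      else (t :: s) ++ psbAux xs [x]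

/-- The map associated with the PSB algorithm. -/
def psb (π : List ℕ) : List ℕ := psbAux π []

/-- `σ` has exactly one preimage under `psb`. -/
def HasUniquePreimage (σ : List ℕ) : Prop := ∃! π : List ℕ, psb π = σ

theorem psbAux_perm (xs s : List ℕ) : (psbAux xs s).Perm (xs ++ s) := by
  fun_induction psbAux xs s with
  | case1 s => simp
  | case2 x xs ih => simpa using ih.trans (List.perm_append_singleton x xs)
  | case3 x xs s ih => exact ih.trans List.perm_middle
  | case4 x xs t s h h' ih => exact ih.cons x
  | case5 x xs t s h h' ih =>
    have h₁ : (psbAux xs [x]).Perm (x :: xs) := ih.trans (List.perm_append_singleton x xs)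
    exact (h₁.append_left (t :: s)).trans List.perm_append_comm

theorem psb_perm (π : List ℕ) : (psb π).Perm π := by
  simpa [psb] using psbAux_perm π []

theorem psbAux_append_cons {M : ℕ} (w : List ℕ) (u s : List ℕ) (hu : ∀ x ∈ u, x < M)
    (hs : ∀ x ∈ s, x < M) : psbAux (u ++ M :: w) s = psbAux u s ++ psbAux w [M] := by
  fun_induction psbAux u s with
  | case1 s =>
    cases s with
    | nil => simp [psbAux]
    | cons t s =>
      have : t < M := hs t (by simp)
      simp [psbAux, show M + 1 ≠ t by omega, show ¬ M + 1 < t by omega]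
  | case2 x xs ih => simp_all [psbAux]
  | case3 x xs s ih =>
    simp only [List.mem_cons, forall_eq_or_imp] at hu hs
    simp [psbAux, ih hu.2 (by simpa using ⟨hu.1, hs⟩)]
  | case4 x xs t s h h' ih => simp_all [psbAux]
  | case5 x xs t s h h' ih => simp_all [psbAux]

theorem psb_append_cons {M : ℕ} (u w : List ℕ) (hu : ∀ x ∈ u, x < M) :
    psb (u ++ M :: w) = psb u ++ psb (M :: w) :=
  psbAux_append_cons w u [] hu (by simp)

theorem psbAux_bypass_append {M : ℕ} (w v : List ℕ) (hw : ∀ x ∈ w, x + 1 < M) :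
    psbAux (w ++ v) [M] = w ++ psbAux v [M] := by
  induction w with
  | nil => rfl
  | cons x w ih =>
    have hx : x + 1 < M := hw x (by simp)
    simp [psbAux, hx, hx.ne, ih fun y hy => hw y (by simp [hy])]

theorem psb_cons_bypass {M : ℕ} (w : List ℕ) (hw : ∀ x ∈ w, x + 1 < M) :
    psb (M :: w) = w ++ [M] := by
  simpa [psb, psbAux] using psbAux_bypass_append w [] hw

theorem psbAux_range' (w : List ℕ) (t r : ℕ) (hw : ∀ x ∈ w, x < t) (hn : w.Nodup) :
    ∃ v, psbAux w (List.range' t (r + 1)) = v ++ List.range' t (r + 1) := by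
  induction w generalizing t r with
  | nil => exact ⟨[], by simp [psbAux]⟩
  | cons x w ih =>
    have hx : x < t := hw x (by simp)
    obtain ⟨hxw, hn⟩ := List.nodup_cons.1 hn
    rcases (Nat.succ_le_of_lt hx).eq_or_lt with rfl | h
    · obtain ⟨v, hv⟩ := ih x (r + 1) (fun y hy => by
        have := hw y (by simp [hy])
        have : y ≠ x := fun e => hxw (e ▸ hy)
        omega) hn
      refine ⟨v ++ [x], ?_⟩
      simp only [List.range'_succ] at hv ⊢
      simp [psbAux, hv]
    · obtain ⟨v, hv⟩ := ih t r (fun y hy => hw y (by simp [hy])) hn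
      refine ⟨x :: v, ?_⟩
      simp only [List.range'_succ] at hv ⊢
      have h : x + 1 < t := h
      simp [psbAux, hv, h, h.ne]

theorem psb_cons_max {M : ℕ} (w : List ℕ) (hw : ∀ x ∈ w, x < M) (hn : w.Nodup) :
    ∃ v, psb (M :: w) = v ++ [M] :=
  psbAux_range' w M 0 hw hn

theorem psb_cons_max_of_pred_mem {M : ℕ} (w : List ℕ) (hw : ∀ x ∈ w, x < M + 1) (hn : w.Nodup)
    (hM : M ∈ w) : ∃ v, psb ((M + 1) :: w) = v ++ [M, M + 1] := by
  obtain ⟨u, v, rfl⟩ := List.append_of_mem hM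
  have hn' := List.nodup_middle.1 hn
  rw [List.nodup_cons] at hn'
  have hlt : ∀ x ∈ u ++ v, x < M := fun x hx => by
    have : x < M + 1 := hw x (by simp at hx ⊢; tauto)
    have : x ≠ M := fun e => hn'.1 (e ▸ hx)
    omega
  obtain ⟨v', hv'⟩ := psbAux_range' v M 1 (fun x hx => hlt x (by simp [hx]))
    (List.Nodup.of_append_right hn'.2)
  refine ⟨u ++ v', ?_⟩
  have h := psbAux_bypass_append (M := M + 1) u (M :: v)
    (fun x hx => Nat.succ_lt_succ (hlt x (by simp [hx])))
  have hv'' : psbAux v [M, M + 1] = v' ++ [M, M + 1] := hv'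
  simp [psb, psbAux, h, hv'']

theorem lt_of_nodup_append_cons {u w : List ℕ} {M : ℕ} (hn : (u ++ M :: w).Nodup)
    (hM : ∀ x ∈ u ++ M :: w, x ≤ M) : ∀ x ∈ u ++ w, x < M := by
  rw [List.nodup_middle, List.nodup_cons] at hn
  intro x hx
  refine lt_of_le_of_ne (hM x ?_) fun e => hn.1 (e ▸ hx)
  simp at hx ⊢
  tauto

theorem exists_split_max {w : List ℕ} (hw : w ≠ []) (hn : w.Nodup) :
    ∃ u M v, w = u ++ M :: v ∧ ∀ x ∈ u ++ v, x < M := by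
  obtain ⟨M, hM, hmax⟩ := w.toFinset.exists_max_image id (by simpa using hw)
  obtain ⟨u, v, rfl⟩ := List.append_of_mem (List.mem_toFinset.1 hM)
  exact ⟨u, M, v, rfl, lt_of_nodup_append_cons hn fun x hx => hmax x (List.mem_toFinset.2 hx)⟩

theorem psb_ends_max {π : List ℕ} {M : ℕ} (hn : π.Nodup) (hM : M ∈ π) (hmax : ∀ x ∈ π, x ≤ M) :
    ∃ v, psb π = v ++ [M] := by
  obtain ⟨u, w, rfl⟩ := List.append_of_mem hM
  have hlt := lt_of_nodup_append_cons hn hmax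
  obtain ⟨v, hv⟩ := psb_cons_max w (fun x hx => hlt x (by simp [hx]))
    (List.nodup_cons.1 (List.Nodup.of_append_right hn)).2
  exact ⟨psb u ++ v, by rw [psb_append_cons u w fun x hx => hlt x (by simp [hx]), hv]; simp⟩

theorem exists_psb_eq {w : List ℕ} {M : ℕ} (hn : w.Nodup) (hw : ∀ x ∈ w, x < M) :
    ∃ π, psb π = w ++ [M] := by
  induction hl : w.length using Nat.strong_induction_on generalizing w M with
  | _ l ih =>
    subst hl
    rcases eq_or_ne w [] with rfl | hne
    · exact ⟨[M], rfl⟩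
    · obtain ⟨u, M', v, rfl, hlt⟩ := exists_split_max hne hn
      obtain ⟨π, hπ⟩ := ih u.length (by simp) (List.Nodup.of_append_left hn)
        (fun x hx => hlt x (by simp [hx])) rfl
      refine ⟨π ++ M :: v, ?_⟩
      have hM' : M' < M := hw M' (by simp)
      rw [psb_append_cons, hπ, psb_cons_bypass]
      · simp
      · intro x hx
        have := hlt x (by simp [hx])
        omega
      · intro x hx
        have hx' := (psb_perm π).mem_iff.2 hx
        rw [hπ] at hx'
        exact hw x (by simp at hx' ⊢; tauto)

theorem append_cons_inj {u u' w w' : List ℕ} {a : ℕ} (hu : a ∉ u) (hu' : a ∉ u')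
    (h : u ++ a :: w = u' ++ a :: w') : u = u' ∧ w = w' := by
  induction u generalizing u' with
  | nil => cases u' <;> simp_all
  | cons x u ih =>
    cases u' with
    | nil => exact absurd (List.cons.inj h).1 fun e => hu (by simp [e])
    | cons y u' =>
      simp only [List.cons_append, List.cons.injEq, List.mem_cons, not_or] at hu hu' h ⊢
      obtain ⟨h₁, h₂⟩ := ih hu.2 hu'.2 h.2
      exact ⟨⟨h.1, h₁⟩, h₂⟩

theorem hasUniquePreimage_singleton (M : ℕ) : HasUniquePreimage [M] := by
  refine ⟨[M], rfl, fun π hπ => ?_⟩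
  have h := psb_perm π
  rw [hπ] at h
  exact (List.singleton_perm.1 h).symm

theorem hasUniquePreimage_iff {u v : List ℕ} {M' M : ℕ} (hn : (u ++ M' :: v).Nodup)
    (hlt : ∀ x ∈ u ++ v, x < M') (hM : M' < M) :
    HasUniquePreimage (u ++ M' :: v ++ [M]) ↔
      M = M' + 1 ∧ v ≠ [] ∧ HasUniquePreimage (u ++ [M']) := by
  have hu : ∀ x ∈ u, x < M' := fun x hx => hlt x (by simp [hx])
  have hv : ∀ x ∈ v, x < M' := fun x hx => hlt x (by simp [hx])
  have key : ∀ π, psb π = u ++ [M'] → psb (π ++ M :: v) = u ++ M' :: v ++ [M] := by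
    intro π hπ
    rw [psb_append_cons, hπ, psb_cons_bypass]
    · simp
    · intro x hx
      have := hv x hx
      omega
    · intro x hx
      have hx' := (psb_perm π).mem_iff.2 hx
      rw [hπ] at hx'
      simp only [List.mem_append, List.mem_singleton] at hx'
      rcases hx' with hx' | rfl
      · exact (hu x hx').trans hM
      · exact hM
  constructor
  · rintro ⟨π₀, -, huniq⟩
    obtain ⟨π₁, hπ₁⟩ := exists_psb_eq (List.Nodup.of_append_left hn) hu
    have hfront : ∀ w, psb (M :: w) ≠ u ++ M' :: v ++ [M] := by
      intro w hw
      have h : M :: w = π₁ ++ M :: v := (huniq _ hw).trans (huniq _ (key _ hπ₁)).symm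
      cases π₁ with
      | nil => simp [psb, psbAux] at hπ₁
      | cons y π₁ =>
        have hy := (psb_perm (y :: π₁)).mem_iff.2 (List.mem_cons_self)
        rw [hπ₁, ← (List.cons.inj h).1] at hy
        simp only [List.mem_append, List.mem_singleton] at hy
        rcases hy with hy | rfl
        · exact absurd (hu M hy) (by omega)
        · omega
    have hsucc : M = M' + 1 := by
      by_contra hne
      refine hfront _ (psb_cons_bypass (u ++ M' :: v) fun x hx => ?_)
      simp only [List.mem_append, List.mem_cons] at hx
      rcases hx with hx | rfl | hx
      · have := hu x hx
        omega
      · omega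
      · have := hv x hx
        omega
    refine ⟨hsucc, ?_, π₁, hπ₁, fun π hπ => ?_⟩
    · rintro rfl
      subst hsucc
      refine hfront (u ++ [M']) ?_
      have h := psbAux_bypass_append (M := M' + 1) u [M'] fun x hx =>
        Nat.succ_lt_succ (hu x hx)
      simp [psb, psbAux, h]
    · exact List.append_cancel_right ((huniq _ (key _ hπ)).trans (huniq _ (key _ hπ₁)).symm)
  · rintro ⟨rfl, hne, π₁, hπ₁, huniq⟩
    refine ⟨_, key π₁ hπ₁, fun π hπ => ?_⟩
    have hperm := psb_perm π
    rw [hπ] at hperm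
    have hle : ∀ x ∈ u ++ M' :: v, x ≤ M' := by
      intro x hx
      simp only [List.mem_append, List.mem_cons] at hx
      rcases hx with hx | rfl | hx
      · exact (hu x hx).le
      · exact le_rfl
      · exact (hv x hx).le
    have hn' : (u ++ M' :: v ++ [M' + 1]).Nodup := by
      refine List.Nodup.append hn (by simp) ?_
      simp only [List.disjoint_singleton]
      intro h
      have := hle _ h
      omega
    have hnπ := hperm.nodup_iff.1 hn'
    obtain ⟨a, b, rfl⟩ := List.append_of_mem (hperm.mem_iff.1 (by simp : M' + 1 ∈ _))
    have hmax : ∀ x ∈ a ++ (M' + 1) :: b, x ≤ M' + 1 := by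
      intro x hx
      have hx' := hperm.mem_iff.2 hx
      rw [List.mem_append, List.mem_singleton] at hx'
      rcases hx' with hx' | rfl
      · exact (hle x hx').trans (Nat.le_succ _)
      · exact le_rfl
    have hab := lt_of_nodup_append_cons hnπ hmax
    have hb : ∀ x ∈ b, x < M' + 1 := fun x hx => hab x (by simp [hx])
    have hnb : b.Nodup := (List.nodup_cons.1 (List.Nodup.of_append_right hnπ)).2
    rw [psb_append_cons a b fun x hx => hab x (by simp [hx])] at hπ
    have hM'b : M' ∉ b := by
      intro hmem
      obtain ⟨c, hc⟩ := psb_cons_max_of_pred_mem b hb hnb hmem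
      obtain ⟨v', z, rfl⟩ := List.eq_nil_or_concat' v |>.resolve_left hne
      have h : (psb a ++ c ++ [M']) ++ [M' + 1] = (u ++ M' :: v' ++ [z]) ++ [M' + 1] := by
        simpa [hc] using hπ
      have h' := List.append_inj_right' (List.append_cancel_right h) rfl
      have hz := hv z (by simp)
      simp at h'
      omega
    have hbb : ∀ x ∈ b, x + 1 < M' + 1 := fun x hx => by
      have := hb x hx
      have : x ≠ M' := fun e => hM'b (e ▸ hx)
      omega
    rw [psb_cons_bypass b hbb] at hπ
    have hM'a : M' ∈ a := by
      have : M' ∈ a ++ (M' + 1) :: b := hperm.mem_iff.1 (by simp)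
      simp at this
      tauto
    have hna := List.Nodup.of_append_left hnπ
    obtain ⟨c, hc⟩ := psb_ends_max hna hM'a fun x hx =>
      Nat.le_of_lt_succ (hab x (by simp [hx]))
    have hcn : (c ++ [M']).Nodup := hc ▸ (psb_perm a).nodup_iff.2 hna
    have h : c ++ M' :: b = u ++ M' :: v := by
      apply List.append_cancel_right (bs := [M' + 1])
      simpa [hc] using hπ
    obtain ⟨rfl, rfl⟩ := append_cons_inj
      (fun hm => by simp [List.nodup_append] at hcn; exact hcn.2 _ hm rfl)
      (fun hm => (hu _ hm).ne rfl) h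
    rw [huniq a hc]

/-- The lists in which the entries `m, …, m + k` are inserted into `τ` in increasing order, `m` in
front, `m + k` at the end, and no two of them next to each other. -/
def separatedInsertions (m : ℕ) : ℕ → List ℕ → Finset (List ℕ)
  | 0, τ => if τ = [] then {[m]} else ∅
  | k + 1, τ => (Finset.range τ.length).biUnion fun i =>
      (separatedInsertions m k (τ.take i)).image (· ++ (τ.drop i ++ [m + k + 1]))

theorem mem_separatedInsertions_zero {m : ℕ} {τ ρ : List ℕ} :
    ρ ∈ separatedInsertions m 0 τ ↔ τ = [] ∧ ρ = [m] := by
  unfold separatedInsertions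
  split_ifs <;> simp_all

theorem mem_separatedInsertions_succ {m k : ℕ} {τ ρ : List ℕ} :
    ρ ∈ separatedInsertions m (k + 1) τ ↔ ∃ τ₁ τ₂ ρ₁, τ = τ₁ ++ τ₂ ∧ τ₂ ≠ [] ∧
      ρ₁ ∈ separatedInsertions m k τ₁ ∧ ρ = ρ₁ ++ (τ₂ ++ [m + k + 1]) := by
  simp only [separatedInsertions, Finset.mem_biUnion, Finset.mem_range, Finset.mem_image]
  constructor
  · rintro ⟨i, hi, ρ₁, hρ₁, rfl⟩
    exact ⟨τ.take i, τ.drop i, ρ₁, by simp, by simpa using hi, hρ₁, rfl⟩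
  · rintro ⟨τ₁, τ₂, ρ₁, rfl, hne, hρ₁, rfl⟩
    exact ⟨τ₁.length, by simpa using List.length_pos_iff.2 hne, ρ₁, by simpa using hρ₁, by simp⟩

theorem perm_of_mem_separatedInsertions {m k : ℕ} {τ ρ : List ℕ}
    (h : ρ ∈ separatedInsertions m k τ) : ρ.Perm (τ ++ List.range' m (k + 1)) := by
  induction k generalizing τ ρ with
  | zero =>
    obtain ⟨rfl, rfl⟩ := mem_separatedInsertions_zero.1 h
    simp
  | succ k ih =>
    obtain ⟨τ₁, τ₂, ρ₁, rfl, -, hρ₁, rfl⟩ := mem_separatedInsertions_succ.1 h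
    rw [List.range'_concat]
    have h₁ := (ih hρ₁).append_right (τ₂ ++ [m + k + 1])
    refine h₁.trans ?_
    rw [List.perm_iff_count]
    intro a
    simp [List.count_append, add_assoc]
    omega

theorem exists_eq_append_of_mem_separatedInsertions {m k : ℕ} {τ ρ : List ℕ}
    (h : ρ ∈ separatedInsertions m k τ) : ∃ u, ρ = u ++ [m + k] := by
  cases k with
  | zero => exact ⟨[], (mem_separatedInsertions_zero.1 h).2⟩
  | succ k =>
    obtain ⟨τ₁, τ₂, ρ₁, -, -, -, rfl⟩ := mem_separatedInsertions_succ.1 h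
    exact ⟨ρ₁ ++ τ₂, by simp [add_assoc]⟩

theorem head?_of_mem_separatedInsertions {m k : ℕ} {τ ρ : List ℕ}
    (h : ρ ∈ separatedInsertions m k τ) : ρ.head? = some m := by
  induction k generalizing τ ρ with
  | zero => simp [(mem_separatedInsertions_zero.1 h).2]
  | succ k ih =>
    obtain ⟨τ₁, τ₂, ρ₁, rfl, -, hρ₁, rfl⟩ := mem_separatedInsertions_succ.1 h
    simp [ih hρ₁]

theorem filter_of_mem_separatedInsertions {m k : ℕ} {τ ρ : List ℕ} (hτ : ∀ x ∈ τ, x < m)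
    (h : ρ ∈ separatedInsertions m k τ) : ρ.filter (· < m) = τ := by
  induction k generalizing τ ρ with
  | zero =>
    obtain ⟨rfl, rfl⟩ := mem_separatedInsertions_zero.1 h
    simp
  | succ k ih =>
    obtain ⟨τ₁, τ₂, ρ₁, rfl, -, hρ₁, rfl⟩ := mem_separatedInsertions_succ.1 h
    have h₂ : τ₂.filter (· < m) = τ₂ :=
      List.filter_eq_self.2 fun x hx => by simpa using hτ x (by simp [hx])
    simp [List.filter_append, ih (fun x hx => hτ x (by simp [hx])) hρ₁, h₂, add_assoc]

theorem le_length_of_mem_separatedInsertions {m k : ℕ} {τ ρ : List ℕ}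
    (h : ρ ∈ separatedInsertions m k τ) : k ≤ τ.length := by
  induction k generalizing τ ρ with
  | zero => simp
  | succ k ih =>
    obtain ⟨τ₁, τ₂, ρ₁, rfl, hne, hρ₁, rfl⟩ := mem_separatedInsertions_succ.1 h
    have := ih hρ₁
    have := List.length_pos_iff.2 hne
    simp only [List.length_append]
    omega

theorem card_separatedInsertions_succ {m : ℕ} (k : ℕ) {τ : List ℕ} (hτ : ∀ x ∈ τ, x < m) :
    (separatedInsertions m (k + 1) τ).card =
      ∑ i ∈ Finset.range τ.length, (separatedInsertions m k (τ.take i)).card := by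
  rw [separatedInsertions, Finset.card_biUnion]
  · exact Finset.sum_congr rfl fun i _ =>
      Finset.card_image_of_injective _ fun a b hab => List.append_cancel_right hab
  · intro i hi j hj hij
    rw [Function.onFun, Finset.disjoint_left]
    intro ρ hρi hρj
    obtain ⟨a, ha, rfl⟩ := Finset.mem_image.1 hρi
    obtain ⟨b, hb, hab⟩ := Finset.mem_image.1 hρj
    have hlen : ∀ {i c}, i ∈ Finset.range τ.length → c ∈ separatedInsertions m k (τ.take i) →
        ∃ u, m + k ∉ u ∧ c = u ++ [m + k] := by
      intro i c hi hc
      obtain ⟨u, rfl⟩ := exists_eq_append_of_mem_separatedInsertions hc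
      refine ⟨u, fun hmem => ?_, rfl⟩
      have hcount := (perm_of_mem_separatedInsertions hc).count_eq (m + k)
      have h₁ : (τ.take i).count (m + k) = 0 := List.count_eq_zero.2 fun hm => by
        have := hτ _ (List.mem_of_mem_take hm)
        omega
      have h₂ : (List.range' m (k + 1)).count (m + k) ≤ 1 :=
        List.nodup_iff_count_le_one.1 (List.nodup_range' ..) _
      have h₃ := List.count_pos_iff.2 hmem
      simp only [List.count_append, List.count_singleton_self] at hcount
      omega
    obtain ⟨u, hu, rfl⟩ := hlen hi ha
    obtain ⟨v, hv, rfl⟩ := hlen hj hb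
    have h := append_cons_inj hv hu (w := τ.drop j ++ [m + k + 1])
      (w' := τ.drop i ++ [m + k + 1]) (by simpa using hab)
    have h' := congrArg List.length h.2
    simp only [Finset.coe_range, Set.mem_Iio, List.length_append, List.length_drop] at h' hi hj
    omega

theorem sum_range_choose_right (l k : ℕ) :
    ∑ i ∈ Finset.range l, i.choose k = l.choose (k + 1) := by
  induction l with
  | zero => simp
  | succ l ih => rw [Finset.sum_range_succ, ih, Nat.choose_succ_succ, add_comm]

theorem card_separatedInsertions {m : ℕ} (k : ℕ) {τ : List ℕ} (hτ : ∀ x ∈ τ, x < m)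
    (hne : τ ≠ []) : (separatedInsertions m (k + 1) τ).card = (τ.length - 1).choose k := by
  obtain ⟨l, hl⟩ : ∃ l, τ.length = l + 1 :=
    Nat.exists_eq_succ_of_ne_zero (List.length_pos_iff.2 hne).ne'
  induction k generalizing τ l with
  | zero =>
    rw [card_separatedInsertions_succ 0 hτ, hl, Finset.sum_range_succ',
      Finset.sum_eq_zero fun i _ => ?_]
    · simp [separatedInsertions]
    · simp [separatedInsertions, hne]
  | succ k ih =>
    rw [card_separatedInsertions_succ (k + 1) hτ, hl, Finset.sum_range_succ', Nat.add_sub_cancel]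
    have h₀ : (separatedInsertions m (k + 1) (τ.take 0)).card = 0 := by
      simp [separatedInsertions]
    rw [h₀, add_zero, ← sum_range_choose_right l k]
    refine Finset.sum_congr rfl fun i hi => ?_
    have hi' := Finset.mem_range.1 hi
    rw [ih (fun x hx => hτ x (List.mem_of_mem_take hx)) (by simpa using hne) i
      (by simp; omega)]
    congr 1
    simp
    omega

theorem hasUniquePreimage_of_mem_separatedInsertions {m k : ℕ} {τ ρ : List ℕ}
    (hn : τ.Nodup) (hτ : ∀ x ∈ τ, x < m) (h : ρ ∈ separatedInsertions m k τ) :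
    HasUniquePreimage ρ := by
  induction k generalizing τ ρ with
  | zero =>
    rw [(mem_separatedInsertions_zero.1 h).2]
    exact hasUniquePreimage_singleton m
  | succ k ih =>
    have hperm := perm_of_mem_separatedInsertions h
    obtain ⟨τ₁, τ₂, ρ₁, rfl, hne, hρ₁, rfl⟩ := mem_separatedInsertions_succ.1 h
    have h₁ := ih (List.Nodup.of_append_left hn) (fun x hx => hτ x (by simp [hx])) hρ₁
    have hnρ : (ρ₁ ++ (τ₂ ++ [m + k + 1])).Nodup := by
      refine hperm.nodup_iff.2 (List.Nodup.append hn (List.nodup_range' ..) ?_)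
      intro x hx hx'
      have := hτ x hx
      have := (List.mem_range'_1.1 hx').1
      omega
    have hle : ∀ x ∈ ρ₁ ++ τ₂, x ≤ m + k := by
      intro x hx
      rw [List.mem_append] at hx
      rcases hx with hx | hx
      · have hx' := (perm_of_mem_separatedInsertions hρ₁).mem_iff.1 hx
        rw [List.mem_append, List.mem_range'_1] at hx'
        rcases hx' with hx' | hx'
        · have := hτ x (by simp [hx'])
          omega
        · omega
      · have := hτ x (by simp [hx])
        omega
    obtain ⟨u, rfl⟩ := exists_eq_append_of_mem_separatedInsertions hρ₁
    rw [← List.append_assoc] at hnρ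
    simp only [List.append_assoc, List.singleton_append] at hnρ hle
    have hn' : (u ++ (m + k) :: τ₂).Nodup := by
      have : (u ++ (m + k) :: τ₂ ++ [m + k + 1]).Nodup := by simpa using hnρ
      exact List.Nodup.of_append_left this
    have := (hasUniquePreimage_iff (M := m + k + 1) hn' (lt_of_nodup_append_cons hn' hle)
      (Nat.lt_succ_self _)).2 ⟨rfl, hne, h₁⟩
    simpa using this

theorem exists_mem_separatedInsertions {w : List ℕ} {M : ℕ} (hn : w.Nodup)
    (hw : ∀ x ∈ w, x < M) (h : HasUniquePreimage (w ++ [M])) :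
    ∃ m k τ, m + k = M ∧ (∀ x ∈ τ, x < m) ∧ w ++ [M] ∈ separatedInsertions m k τ := by
  induction hl : w.length using Nat.strong_induction_on generalizing w M with
  | _ l ih =>
    subst hl
    rcases eq_or_ne w [] with rfl | hne
    · exact ⟨M, 0, [], rfl, by simp, mem_separatedInsertions_zero.2 ⟨rfl, rfl⟩⟩
    · obtain ⟨u, M', v, rfl, hlt⟩ := exists_split_max hne hn
      obtain ⟨rfl, hv, hu⟩ := (hasUniquePreimage_iff hn hlt (hw M' (by simp))).1 h
      obtain ⟨m, k, τ, rfl, hτ, hmem⟩ := ih u.length (by simp) (List.Nodup.of_append_left hn)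
        (fun x hx => hlt x (by simp [hx])) hu rfl
      refine ⟨m, k + 1, τ ++ v, by omega, fun x hx => ?_, mem_separatedInsertions_succ.2
        ⟨τ, v, _, rfl, hv, hmem, by simp⟩⟩
      rw [List.mem_append] at hx
      rcases hx with hx | hx
      · exact hτ x hx
      · by_contra hmx
        have hxlt := hlt x (by simp [hx])
        have hxu : x ∈ u ++ [m + k] := (perm_of_mem_separatedInsertions hmem).mem_iff.2
          (List.mem_append_right _ (List.mem_range'_1.2 ⟨by omega, by omega⟩))
        have hdis : (u ++ [m + k] ++ v).Nodup := by simpa using hn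
        exact List.disjoint_of_nodup_append hdis hxu hx

theorem card_preimages_eq_one_iff {n : ℕ} {σ : List ℕ} (hσ : IsPermList n σ) :
    Nat.card {π : List ℕ // IsPermList n π ∧ psb π = σ} = 1 ↔ HasUniquePreimage σ := by
  rw [Nat.card_eq_one_iff_exists]
  constructor
  · rintro ⟨⟨π, hπ⟩, h⟩
    refine ⟨π, hπ.2, fun π' hπ' => ?_⟩
    have hperm := psb_perm π'
    rw [hπ'] at hperm
    exact congrArg Subtype.val (h ⟨π', hperm.symm.trans hσ, hπ'⟩)
  · rintro ⟨π, hπ, h⟩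
    have hperm := psb_perm π
    rw [hπ] at hperm
    exact ⟨⟨π, hperm.symm.trans hσ, hπ⟩, fun π' => Subtype.ext (h _ π'.2.2)⟩

theorem range'_one_perm {m k : ℕ} (hm : 1 ≤ m) :
    List.range' 1 (m + k) = List.range' 1 (m - 1) ++ List.range' m (k + 1) := by
  obtain ⟨m, rfl⟩ := Nat.exists_eq_add_of_le' hm
  rw [Nat.add_sub_cancel, show m + 1 + k = m + (k + 1) by ring, List.range'_append_1.symm,
    add_comm 1 m]

theorem isPermList_and_hasUniquePreimage_iff {n : ℕ} (hn : 3 ≤ n) (σ : List ℕ) :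
    IsPermList n σ ∧ HasUniquePreimage σ ↔ ∃ k ∈ Finset.Icc 2 ((n + 1) / 2),
      ∃ τ, τ.Perm (List.range' 1 (n - k)) ∧ σ ∈ separatedInsertions (n - k + 1) (k - 1) τ := by
  constructor
  · rintro ⟨hσ, hu⟩
    obtain ⟨π, hπ, -⟩ := id hu
    have hnσ : σ.Nodup := hσ.nodup_iff.2 (List.nodup_range' ..)
    have hperm := psb_perm π
    rw [hπ] at hperm
    have hmem : ∀ x, x ∈ σ ↔ 1 ≤ x ∧ x < 1 + n := fun x => by
      rw [hσ.mem_iff, List.mem_range'_1]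
    obtain ⟨w, hw⟩ := psb_ends_max (M := n) (hperm.nodup_iff.1 hnσ)
      (hperm.mem_iff.1 ((hmem n).2 (by omega))) fun x hx => by
        have := (hmem x).1 (hperm.mem_iff.2 hx)
        omega
    obtain rfl := hπ.symm.trans hw
    have hlt := lt_of_nodup_append_cons hnσ fun x hx => by
      have := (hmem x).1 hx
      omega
    rw [List.append_nil] at hlt
    obtain ⟨m, k, τ, hmk, hτ, hin⟩ := exists_mem_separatedInsertions
      (List.Nodup.of_append_left hnσ) hlt hu
    have hp := perm_of_mem_separatedInsertions hin
    have hm : 1 ≤ m := ((hmem m).1 (hp.mem_iff.2 (by simp))).1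
    have hτp : τ.Perm (List.range' 1 (m - 1)) := by
      rw [← List.perm_append_right_iff (List.range' m (k + 1)), ← range'_one_perm hm, hmk]
      exact hp.symm.trans hσ
    have hlen := hτp.length_eq
    rw [List.length_range'] at hlen
    have hk := le_length_of_mem_separatedInsertions hin
    have hk0 : k ≠ 0 := by
      rintro rfl
      have := (mem_separatedInsertions_zero.1 hin).1
      subst this
      simp at hlen
      omega
    refine ⟨k + 1, Finset.mem_Icc.2 ⟨by omega, by omega⟩, τ, ?_, ?_⟩
    · rwa [show n - (k + 1) = m - 1 by omega]
    · rwa [show n - (k + 1) + 1 = m by omega, Nat.add_sub_cancel]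
  · rintro ⟨k, hk, τ, hτ, hin⟩
    rw [Finset.mem_Icc] at hk
    refine ⟨?_, hasUniquePreimage_of_mem_separatedInsertions
      (hτ.nodup_iff.2 (List.nodup_range' ..)) (fun x hx => ?_) hin⟩
    · have h := range'_one_perm (m := n - k + 1) (k := k - 1) (by omega)
      rw [Nat.add_sub_cancel, show n - k + 1 + (k - 1) = n by omega] at h
      rw [IsPermList, h]
      exact (perm_of_mem_separatedInsertions hin).trans (hτ.append_right _)
    · have := List.mem_range'_1.1 (hτ.mem_iff.1 hx)
      omega

theorem psb_one_preimage_count (n : ℕ) (hn : 3 ≤ n) :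
    Nat.card {σ : List ℕ // IsPermList n σ ∧
        Nat.card {π : List ℕ // IsPermList n π ∧ psb π = σ} = 1}
      = ∑ k ∈ Finset.Icc 2 ((n + 1) / 2),
          Nat.factorial (n - k) * Nat.choose (n - k - 1) (k - 2) := by
  have hlt : ∀ {k : ℕ} {τ : List ℕ}, τ ∈ (List.range' 1 (n - k)).permutations.toFinset →
      ∀ x ∈ τ, x < n - k + 1 := fun hτ x hx => by
    rw [List.mem_toFinset, List.mem_permutations] at hτ
    have := List.mem_range'_1.1 (hτ.mem_iff.1 hx)
    omega
  let S : Finset (List ℕ) := (Finset.Icc 2 ((n + 1) / 2)).biUnion fun k =>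
    (List.range' 1 (n - k)).permutations.toFinset.biUnion fun τ =>
      separatedInsertions (n - k + 1) (k - 1) τ
  have hS : ∀ σ : List ℕ, (IsPermList n σ ∧
      Nat.card {π : List ℕ // IsPermList n π ∧ psb π = σ} = 1) ↔ σ ∈ S := fun σ => by
    rw [and_congr_right fun h => card_preimages_eq_one_iff h,
      isPermList_and_hasUniquePreimage_iff hn]
    simp [S, List.mem_permutations]
  rw [Nat.card_congr (Equiv.subtypeEquivRight hS), Nat.card_eq_fintype_card, Fintype.card_coe,
    Finset.card_biUnion]
  · refine Finset.sum_congr rfl fun k hk => ?_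
    rw [Finset.mem_Icc] at hk
    rw [Finset.card_biUnion]
    · rw [Finset.sum_congr rfl fun τ hτ => ?_, Finset.sum_const, List.toFinset_card_of_nodup
        (List.nodup_permutations _ (List.nodup_range' ..)), List.length_permutations,
        List.length_range', smul_eq_mul]
      have hlen : τ.length = n - k := by
        rw [List.mem_toFinset, List.mem_permutations] at hτ
        simpa using hτ.length_eq
      obtain ⟨j, rfl⟩ := Nat.exists_eq_add_of_le' hk.1
      rw [show j + 2 - 1 = j + 1 by omega, card_separatedInsertions j (hlt hτ), hlen,
        Nat.add_sub_cancel]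
      rw [← List.length_pos_iff]
      omega
    · intro τ hτ τ' hτ' hne
      rw [Function.onFun, Finset.disjoint_left]
      intro ρ hρ hρ'
      exact hne ((filter_of_mem_separatedInsertions (hlt hτ) hρ).symm.trans
        (filter_of_mem_separatedInsertions (hlt hτ') hρ'))
  · intro k hk k' hk' hne
    rw [Function.onFun, Finset.disjoint_left]
    intro ρ hρ hρ'
    obtain ⟨τ, -, hτ⟩ := Finset.mem_biUnion.1 hρ
    obtain ⟨τ', -, hτ'⟩ := Finset.mem_biUnion.1 hρ'
    have h := (head?_of_mem_separatedInsertions hτ).symm.trans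
      (head?_of_mem_separatedInsertions hτ')
    simp only [Finset.coe_Icc, Set.mem_Icc, Option.some.injEq] at h hk hk'
    omega
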